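/- arXiv:2108.12975 — 6 statements merged into one kernel-verified Lean document; each statement's English description precedes it below -/
import Mathlib

section
/- For every real α > 0 and all integers j, k ∈ ℤ, the integral over ℝ of ρ_j(x)·conj(ρ_k(x)) equals π/α when j = k and equals 0 when j ≠ k (orthogonality of the rational basis functions). -/
open MeasureTheory

/-- The rational basis function `ρ_k(x) = (α + i x)^k / (α - i x)^(k+1)` (integer powers). -/
noncomputable def rho (α : ℝ) (k : ℤ) (x : ℝ) : ℂ :=
  ((α : ℂ) + Complex.I * x) ^ k / ((α : ℂ) - Complex.I * x) ^ (k + 1)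

open Filter Topology

lemma add_I_mul_ne_zero {α : ℝ} (hα : 0 < α) (x : ℝ) : (α : ℂ) + Complex.I * x ≠ 0 := by
  intro h
  have := congrArg Complex.re h
  simp at this
  exact hα.ne' this

lemma sub_I_mul_ne_zero {α : ℝ} (hα : 0 < α) (x : ℝ) : (α : ℂ) - Complex.I * x ≠ 0 := by
  simpa [sub_eq_add_neg] using add_I_mul_ne_zero hα (-x)

lemma add_I_mul_mul_sub_I_mul (α x : ℝ) :
    ((α : ℂ) + Complex.I * x) * ((α : ℂ) - Complex.I * x) = ((α ^ 2 + x ^ 2 : ℝ) : ℂ) := by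
  push_cast
  linear_combination (-(x : ℂ) ^ 2) * Complex.I_sq

/-- The Cayley transform `(α + i x) / (α - i x)` of the real line onto the punctured circle. -/
noncomputable def cayley (α x : ℝ) : ℂ :=
  ((α : ℂ) + Complex.I * x) / ((α : ℂ) - Complex.I * x)

lemma cayley_ne_zero {α : ℝ} (hα : 0 < α) (x : ℝ) : cayley α x ≠ 0 :=
  div_ne_zero (add_I_mul_ne_zero hα x) (sub_I_mul_ne_zero hα x)

lemma norm_cayley {α : ℝ} (hα : 0 < α) (x : ℝ) : ‖cayley α x‖ = 1 := by
  have h : (α : ℂ) + Complex.I * x = (starRingEnd ℂ) ((α : ℂ) - Complex.I * x) := by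
    simp
  rw [cayley, norm_div, h, Complex.norm_conj,
    div_self (norm_ne_zero_iff.mpr (sub_I_mul_ne_zero hα x))]

lemma rho_mul_conj_rho {α : ℝ} (hα : 0 < α) (j k : ℤ) (x : ℝ) :
    rho α j x * (starRingEnd ℂ) (rho α k x) =
      cayley α x ^ (j - k) * (((α ^ 2 + x ^ 2)⁻¹ : ℝ) : ℂ) := by
  have hA := add_I_mul_ne_zero hα x
  have hB := sub_I_mul_ne_zero hα x
  rw [Complex.ofReal_inv, ← add_I_mul_mul_sub_I_mul]
  simp only [rho, cayley, map_div₀, map_zpow₀, map_add, map_sub, map_mul, Complex.conj_I,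
    Complex.conj_ofReal, neg_mul, sub_neg_eq_add, ← sub_eq_add_neg]
  rw [zpow_sub₀ (div_ne_zero hA hB), div_zpow, div_zpow, zpow_add_one₀ hA, zpow_add_one₀ hB]
  have := zpow_ne_zero j hA
  have := zpow_ne_zero k hA
  have := zpow_ne_zero j hB
  have := zpow_ne_zero k hB
  generalize ((α : ℂ) + Complex.I * x) ^ j = a at *
  generalize ((α : ℂ) + Complex.I * x) ^ k = b at *
  generalize ((α : ℂ) - Complex.I * x) ^ j = c at *
  generalize ((α : ℂ) - Complex.I * x) ^ k = d at *
  field_simp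

lemma hasDerivAt_cayley {α : ℝ} (hα : 0 < α) (x : ℝ) :
    HasDerivAt (cayley α)
      (2 * α * Complex.I * cayley α x * (((α ^ 2 + x ^ 2)⁻¹ : ℝ) : ℂ)) x := by
  have hA := add_I_mul_ne_zero hα x
  have hB := sub_I_mul_ne_zero hα x
  have hx : HasDerivAt (fun y : ℝ => Complex.I * (y : ℂ)) Complex.I x := by
    simpa using (Complex.ofRealCLM.hasDerivAt (x := x)).const_mul Complex.I
  convert! (hx.const_add (α : ℂ)).div (hx.const_sub (α : ℂ)) hB using 1
  rw [Complex.ofReal_inv, ← add_I_mul_mul_sub_I_mul, cayley]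
  field_simp
  ring

lemma hasDerivAt_cayley_zpow {α : ℝ} (hα : 0 < α) (m : ℤ) (x : ℝ) :
    HasDerivAt (fun y => cayley α y ^ m)
      (2 * α * Complex.I * m * (cayley α x ^ m * (((α ^ 2 + x ^ 2)⁻¹ : ℝ) : ℂ))) x := by
  have hc := cayley_ne_zero hα x
  convert! (hasDerivAt_zpow m _ (Or.inl hc)).comp x (hasDerivAt_cayley hα x) using 1
  rw [zpow_sub_one₀ hc]
  field_simp

lemma tendsto_cayley_cocompact {α : ℝ} (hα : 0 < α) :
    Tendsto (cayley α) (cocompact ℝ) (𝓝 (-1)) := by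
  have hB : Tendsto (fun x : ℝ => ‖(α : ℂ) - Complex.I * x‖) (cocompact ℝ) atTop := by
    refine tendsto_atTop_mono (fun x => ?_) (tendsto_norm_cocompact_atTop (E := ℝ))
    simpa using Complex.abs_im_le_norm ((α : ℂ) - Complex.I * x)
  have h := ((tendsto_inv₀_cobounded.comp
    (tendsto_norm_atTop_iff_cobounded.mp hB)).const_mul (2 * α : ℂ)).const_add (-1)
  rw [mul_zero, add_zero] at h
  refine h.congr fun x => ?_
  have := sub_I_mul_ne_zero hα x
  simp only [Function.comp_apply, cayley]
  field_simp
  ring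

lemma inv_sq_add_sq_eq {α : ℝ} (hα : 0 < α) (x : ℝ) :
    (α ^ 2 + x ^ 2)⁻¹ = (α ^ 2)⁻¹ * (1 + (α⁻¹ * x) ^ 2)⁻¹ := by
  rw [← mul_inv]
  congr 1
  field_simp

lemma integrable_inv_sq_add_sq {α : ℝ} (hα : 0 < α) :
    Integrable fun x : ℝ => (α ^ 2 + x ^ 2)⁻¹ := by
  simp_rw [inv_sq_add_sq_eq hα]
  exact (integrable_inv_one_add_sq.comp_mul_left' (inv_ne_zero hα.ne')).const_mul _

lemma integral_univ_inv_sq_add_sq {α : ℝ} (hα : 0 < α) :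
    ∫ x : ℝ, (α ^ 2 + x ^ 2)⁻¹ = Real.pi / α := by
  simp_rw [inv_sq_add_sq_eq hα]
  rw [integral_const_mul, Measure.integral_comp_mul_left (fun x : ℝ => (1 + x ^ 2)⁻¹),
    integral_univ_inv_one_add_sq, inv_inv, abs_of_pos hα, smul_eq_mul]
  field_simp

lemma integrable_cayley_zpow_mul {α : ℝ} (hα : 0 < α) (m : ℤ) :
    Integrable fun x : ℝ => cayley α x ^ m * (((α ^ 2 + x ^ 2)⁻¹ : ℝ) : ℂ) := by
  have hc : Continuous fun x : ℝ => cayley α x ^ m :=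
    continuous_iff_continuousAt.mpr fun x => (hasDerivAt_cayley_zpow hα m x).continuousAt
  refine (integrable_inv_sq_add_sq hα).ofReal.bdd_mul (c := 1) hc.aestronglyMeasurable
    (.of_forall fun x => ?_)
  rw [norm_zpow, norm_cayley hα, one_zpow]

lemma integral_cayley_zpow_mul {α : ℝ} (hα : 0 < α) {m : ℤ} (hm : m ≠ 0) :
    ∫ x : ℝ, cayley α x ^ m * (((α ^ 2 + x ^ 2)⁻¹ : ℝ) : ℂ) = 0 := by
  have hlim : Tendsto (fun x => cayley α x ^ m) (cocompact ℝ) (𝓝 ((-1) ^ m)) :=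
    (tendsto_cayley_cocompact hα).zpow₀ m (Or.inl (by simp))
  have h := integral_of_hasDerivAt_of_tendsto (hasDerivAt_cayley_zpow hα m)
    ((integrable_cayley_zpow_mul hα m).const_mul _)
    (hlim.mono_left atBot_le_cocompact) (hlim.mono_left atTop_le_cocompact)
  rw [integral_const_mul, sub_self] at h
  refine (mul_eq_zero.mp h).resolve_left ?_
  simp [hα.ne', hm]

/-- Orthogonality of the rational basis functions:
`∫ ρ_j(x) conj(ρ_k(x)) dx = (π/α) δ_{j,k}`. -/
theorem rho_orthogonality (α : ℝ) (hα : 0 < α) (j k : ℤ) :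
    ∫ x : ℝ, rho α j x * (starRingEnd ℂ) (rho α k x) =
      if j = k then ((Real.pi / α : ℝ) : ℂ) else 0 := by
  simp_rw [rho_mul_conj_rho hα]
  split_ifs with h
  · simp_rw [h, sub_self, zpow_zero, one_mul]
    rw [integral_complex_ofReal, integral_univ_inv_sq_add_sq hα]
  · exact integral_cayley_zpow_mul hα (sub_ne_zero.mpr h)
end

section
/- For every real α > 0, every integer k ∈ ℤ, and every x ∈ ℝ, the function ρ_k is differentiable at x with derivative (i/(2α))·( k·ρ_{k−1}(x) + (2k+1)·ρ_k(x) + (k+1)·ρ_{k+1}(x) ) (the three-term derivative recurrence underlying the differentiation matrix S1). -/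
/-- The three-term derivative recurrence for the rational basis functions:
`ρ_k'(x) = (i/(2α)) (k ρ_{k-1}(x) + (2k+1) ρ_k(x) + (k+1) ρ_{k+1}(x))`. -/
theorem rho_hasDerivAt (α : ℝ) (hα : 0 < α) (k : ℤ) (x : ℝ) :
    HasDerivAt (rho α k)
      ((Complex.I / (2 * α)) *
        ((k : ℂ) * rho α (k - 1) x + (2 * (k : ℂ) + 1) * rho α k x
          + ((k : ℂ) + 1) * rho α (k + 1) x)) x := by
  have two_alpha_ne : (2 * (α : ℂ)) ≠ 0 := by
    exact_mod_cast (by positivity : (2 * α) ≠ 0)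
  have a_ne : (α : ℂ) + Complex.I * x ≠ 0 := fun h => hα.ne' <| by
    simpa using congrArg Complex.re h
  have b_ne : (α : ℂ) - Complex.I * x ≠ 0 := fun h => hα.ne' <| by
    simpa using congrArg Complex.re h
  have hx : HasDerivAt (fun y : ℝ => Complex.I * (y : ℂ)) Complex.I x := by
    simpa using (Complex.ofRealCLM.hasDerivAt (x := x)).const_mul Complex.I
  have ha := (hasDerivAt_zpow k _ (Or.inl a_ne)).comp x (hx.const_add (α : ℂ))
  have hb := (hasDerivAt_zpow (k + 1) _ (Or.inl b_ne)).comp x (hx.const_sub (α : ℂ))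
  refine (ha.div hb (zpow_ne_zero _ b_ne)).congr_deriv ?_
  have hsum : 2 * (α : ℂ) = (α + Complex.I * x) + (α - Complex.I * x) := by ring
  simp only [rho, Function.comp_apply]
  rw [hsum] at two_alpha_ne ⊢
  generalize (α : ℂ) + Complex.I * x = a at *
  generalize (α : ℂ) - Complex.I * x = b at *
  simp only [zpow_add₀ a_ne, zpow_add₀ b_ne, zpow_sub₀ a_ne, zpow_sub₀ b_ne, zpow_one]
  have hbk := zpow_ne_zero k b_ne
  generalize a ^ k = A
  generalize b ^ k = B at *
  push_cast
  field_simp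
  ring
end

section
/- The discrete Hilbert transform matrix H commutes with the differentiation matrix S1 (H·S1 = S1·H); consequently, the product H·S1 is Hermitian ((H·S1)ᴴ = H·S1) and the product H·S2 is anti-Hermitian ((H·S2)ᴴ = −H·S2). -/
open Matrix Complex BigOperators

noncomputable section

/-- The shifted integer index `k̂ = k - N/2` associated to `k ∈ Fin N`. -/
def khat (N : ℕ) (k : Fin N) : ℤ := (k : ℤ) - (N : ℤ) / 2

/-- The collocation angles `θ_j = 2π ĵ / N`. -/
def theta (N : ℕ) (j : Fin N) : ℝ := 2 * Real.pi * (khat N j : ℝ) / N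

/-- The discrete Fourier matrix `F`, `F_{k,j} = (1/N) exp(-i k̂ θ_j)`. -/
def Fm (N : ℕ) : Matrix (Fin N) (Fin N) ℂ :=
  Matrix.of fun k j => (N : ℂ)⁻¹ * Complex.exp (-Complex.I * (khat N k : ℂ) * (theta N j : ℂ))

/-- The inverse discrete Fourier matrix `G`, `G_{j,k} = exp(i k̂ θ_j)`. -/
def Gm (N : ℕ) : Matrix (Fin N) (Fin N) ℂ :=
  Matrix.of fun j k => Complex.exp (Complex.I * (khat N k : ℂ) * (theta N j : ℂ))

/-- The diagonal weight matrix `P = diag(α - i x_j)`. -/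
def Pm (N : ℕ) (α : ℝ) (x : Fin N → ℝ) : Matrix (Fin N) (Fin N) ℂ :=
  Matrix.diagonal fun j => (α : ℂ) - Complex.I * (x j : ℂ)

/-- The diagonal matrix `P⁻¹ = diag((α - i x_j)⁻¹)`. -/
def PinvM (N : ℕ) (α : ℝ) (x : Fin N → ℝ) : Matrix (Fin N) (Fin N) ℂ :=
  Matrix.diagonal fun j => ((α : ℂ) - Complex.I * (x j : ℂ))⁻¹

/-- The diagonal matrix `P̄ = diag(α + i x_j)`. -/
def PbarM (N : ℕ) (α : ℝ) (x : Fin N → ℝ) : Matrix (Fin N) (Fin N) ℂ :=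
  Matrix.diagonal fun j => (α : ℂ) + Complex.I * (x j : ℂ)

/-- The discrete Hilbert transform matrix `H = diag(-i sgn(k̂))` with `sgn(0) = 1`. -/
def Hm (N : ℕ) : Matrix (Fin N) (Fin N) ℂ :=
  Matrix.diagonal fun k => if 0 ≤ khat N k then -Complex.I else Complex.I

/-- The tridiagonal differentiation matrix `S1`:
`(S1)_{k,k-1} = i k̂/(2α)`, `(S1)_{k,k} = i (2k̂+1)/(2α)`, `(S1)_{k,k+1} = i (k̂+1)/(2α)`. -/
def S1 (N : ℕ) (α : ℝ) : Matrix (Fin N) (Fin N) ℂ :=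
  Matrix.of fun k l =>
    if (l : ℤ) = (k : ℤ) - 1 then Complex.I * (khat N k : ℂ) / (2 * (α : ℂ))
    else if (l : ℤ) = (k : ℤ) then Complex.I * (2 * (khat N k : ℂ) + 1) / (2 * (α : ℂ))
    else if (l : ℤ) = (k : ℤ) + 1 then Complex.I * ((khat N k : ℂ) + 1) / (2 * (α : ℂ))
    else 0

/-- The second-derivative matrix `S2 = S1 · S1`. -/
def S2 (N : ℕ) (α : ℝ) : Matrix (Fin N) (Fin N) ℂ := S1 N α * S1 N α

/-- The discrete inner product `⟨u,v⟩_h = (π/(Nα)) Σ_j (α² + x_j²) u_j conj(v_j)`. -/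
def iph (N : ℕ) (α : ℝ) (x : Fin N → ℝ) (u v : Fin N → ℂ) : ℂ :=
  ((Real.pi / (N * α) : ℝ) : ℂ) *
    ∑ j, ((α ^ 2 + x j ^ 2 : ℝ) : ℂ) * u j * (starRingEnd ℂ) (v j)

/-- The conjugated first-derivative operator `B_{S1} = P⁻¹ G S1 F P`. -/
def BS1 (N : ℕ) (α : ℝ) (x : Fin N → ℝ) : Matrix (Fin N) (Fin N) ℂ :=
  PinvM N α x * Gm N * S1 N α * Fm N * Pm N α x

/-- The conjugated operator `B_{HS1} = P⁻¹ G H S1 F P`. -/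
def BHS1 (N : ℕ) (α : ℝ) (x : Fin N → ℝ) : Matrix (Fin N) (Fin N) ℂ :=
  PinvM N α x * Gm N * Hm N * S1 N α * Fm N * Pm N α x

/-- The conjugated dispersion operator `B_{HS2} = P⁻¹ G H S2 F P`. -/
def BHS2 (N : ℕ) (α : ℝ) (x : Fin N → ℝ) : Matrix (Fin N) (Fin N) ℂ :=
  PinvM N α x * Gm N * Hm N * S2 N α * Fm N * Pm N α x

/-- Coercion of a real vector into a complex vector. -/
def cv (N : ℕ) (u : Fin N → ℝ) : Fin N → ℂ := fun j => (u j : ℂ)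

/-- Entrywise `m`-th power of a complex vector. -/
def pw (N : ℕ) (m : ℕ) (u : Fin N → ℂ) : Fin N → ℂ := fun j => u j ^ m

/-- The mass-conservative semi-discrete right-hand side
`f_M(w) = B_{HS2} w - (1/(m+1)) (w^{∘(m-1)} ⊙ (B_{S1} w) + B_{S1}(w^{∘m}))`. -/
def fM (N : ℕ) (α : ℝ) (x : Fin N → ℝ) (m : ℕ) (w : Fin N → ℂ) : Fin N → ℂ :=
  fun j => (BHS2 N α x *ᵥ w) j
    - (1 / ((m : ℂ) + 1)) *
        ((w j) ^ (m - 1) * (BS1 N α x *ᵥ w) j + (BS1 N α x *ᵥ pw N m w) j)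

/-- The energy-conservative semi-discrete right-hand side
`f_E(w) = -B_{S1}(-B_{HS1} w + (1/m) w^{∘m})`. -/
def fE (N : ℕ) (α : ℝ) (x : Fin N → ℝ) (m : ℕ) (w : Fin N → ℂ) : Fin N → ℂ :=
  -(BS1 N α x *ᵥ (-(BHS1 N α x *ᵥ w) + (1 / (m : ℂ)) • pw N m w))

/-- The semi-discrete energy
`E_h(w) = (1/2)⟨B_{HS1} w, w⟩_h - (1/(m(m+1)))⟨w^{∘m}, w⟩_h`. -/
def Eh (N : ℕ) (α : ℝ) (x : Fin N → ℝ) (m : ℕ) (w : Fin N → ℂ) : ℂ :=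
  (1 / 2 : ℂ) * iph N α x (BHS1 N α x *ᵥ w) w
    - (1 / ((m : ℂ) * ((m : ℂ) + 1))) * iph N α x (pw N m w) w

end

theorem khat_eq_add_one {N : ℕ} {k l : Fin N} (h : (l : ℤ) = (k : ℤ) + 1) :
    khat N l = khat N k + 1 := by
  unfold khat
  omega

theorem conjTranspose_S1 (N : ℕ) (α : ℝ) : (S1 N α)ᴴ = -S1 N α := by
  ext k l
  simp only [S1, conjTranspose_apply, Matrix.neg_apply, of_apply]
  by_cases h₁ : (l : ℤ) = (k : ℤ) - 1
  · have h : (k : ℤ) = (l : ℤ) + 1 := by omega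
    rw [if_neg (by omega), if_neg (by omega), if_pos h, if_pos h₁, khat_eq_add_one h]
    simp
    ring
  by_cases h₂ : (l : ℤ) = (k : ℤ)
  · obtain rfl : l = k := by ext; omega
    rw [if_neg h₁, if_pos rfl]
    simp
    ring
  by_cases h₃ : (l : ℤ) = (k : ℤ) + 1
  · rw [if_pos (by omega), if_neg h₁, if_neg h₂, if_pos h₃, khat_eq_add_one h₃]
    simp
    ring
  rw [if_neg (by omega), if_neg (by omega), if_neg (by omega), if_neg h₁, if_neg h₂, if_neg h₃]
  simp

theorem conjTranspose_Hm (N : ℕ) : (Hm N)ᴴ = -Hm N := by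
  rw [Hm, diagonal_conjTranspose, diagonal_neg]
  congr 1
  ext k
  simp only [Pi.star_apply]
  split_ifs <;> simp

/-- The coupling of `S1` between the modes `-1` and `0` vanishes, so `S1` preserves the
sign of the frequency. -/
theorem commute_Hm_S1 (N : ℕ) (α : ℝ) : Commute (Hm N) (S1 N α) := by
  ext k l
  rw [Hm, diagonal_mul, mul_diagonal]
  by_cases hs : 0 ≤ khat N k ↔ 0 ≤ khat N l
  · simp only [hs, mul_comm]
  suffices h : S1 N α k l = 0 by simp [h]
  simp only [S1, of_apply]
  split_ifs with h₁ h₂ h₃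
  · have h := khat_eq_add_one (k := l) (l := k) (by omega)
    have h0 : khat N k = 0 := by omega
    simp [h0]
  · exact absurd (by unfold khat; omega) hs
  · have h := khat_eq_add_one h₃
    have h0 : khat N k = -1 := by omega
    simp [h0]
  · rfl

/-- The discrete Hilbert transform matrix `H` commutes with the differentiation
matrix `S1`; consequently `H S1` is Hermitian and `H S2` is anti-Hermitian. -/
theorem H_commutes_S1 (N : ℕ) (hN : Even N) (hN0 : 0 < N) (α : ℝ) (hα : 0 < α) :
    Hm N * S1 N α = S1 N α * Hm N ∧
    (Hm N * S1 N α)ᴴ = Hm N * S1 N α ∧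
    (Hm N * S2 N α)ᴴ = -(Hm N * S2 N α) := by
  have hc : Hm N * S1 N α = S1 N α * Hm N := commute_Hm_S1 N α
  refine ⟨hc, ?_, ?_⟩
  · rw [conjTranspose_mul, conjTranspose_S1, conjTranspose_Hm, neg_mul_neg, hc]
  · rw [S2, conjTranspose_mul, conjTranspose_mul, conjTranspose_S1, conjTranspose_Hm,
      neg_mul_neg, mul_neg, ((commute_Hm_S1 N α).mul_right (commute_Hm_S1 N α)).eq]
end

section
/- The conjugated first-derivative matrix M1 := Pbar·G·S1·F·P is anti-Hermitian: M1ᴴ = −M1. -/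
open Matrix Complex BigOperators

theorem conjTranspose_Pm (N : ℕ) (α : ℝ) (x : Fin N → ℝ) : (Pm N α x)ᴴ = PbarM N α x := by
  rw [Pm, PbarM, diagonal_conjTranspose]
  congr 1
  ext j
  simp [sub_eq_add_neg]

theorem conjTranspose_Fm (N : ℕ) : (Fm N)ᴴ = (N : ℂ)⁻¹ • Gm N := by
  ext j k
  simp [Fm, Gm, ← Complex.exp_conj]

/-- The conjugated first-derivative matrix `M1 = P̄ G S1 F P` is anti-Hermitian. -/
theorem M1_antiHermitian (N : ℕ) (hN : Even N) (hN0 : 0 < N)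
    (α : ℝ) (hα : 0 < α) (x : Fin N → ℝ) :
    (PbarM N α x * Gm N * S1 N α * Fm N * Pm N α x)ᴴ
      = -(PbarM N α x * Gm N * S1 N α * Fm N * Pm N α x) := by
  have hG : Gm N = (N : ℂ) • (Fm N)ᴴ := by
    rw [conjTranspose_Fm, smul_smul, mul_inv_cancel₀ (by exact_mod_cast hN0.ne'), one_smul]
  rw [hG, ← conjTranspose_Pm]
  simp [conjTranspose_mul, conjTranspose_S1, Matrix.mul_assoc]
end

section
/- The conjugated energy matrix M3 := Pbar·G·H·S1·F·P is Hermitian: M3ᴴ = M3. -/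
open Matrix Complex BigOperators

theorem conjTranspose_PbarM (N : ℕ) (α : ℝ) (x : Fin N → ℝ) : (PbarM N α x)ᴴ = Pm N α x := by
  rw [← conjTranspose_Pm, conjTranspose_conjTranspose]

theorem conjTranspose_Gm (N : ℕ) (hN0 : 0 < N) : (Gm N)ᴴ = (N : ℂ) • Fm N := by
  have hN : (N : ℂ) ≠ 0 := by exact_mod_cast hN0.ne'
  ext k j
  simp [Fm, Gm, ← Complex.exp_conj, hN]

/-- Both off-diagonal entries of `H * S1` between `k̂ - 1` and `k̂` equal `|k̂| / (2α)`. -/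
theorem isHermitian_Hm_mul_S1 (N : ℕ) (α : ℝ) : (Hm N * S1 N α).IsHermitian := by
  ext k l
  simp only [conjTranspose_apply, Hm, diagonal_mul, S1, of_apply]
  have hkl : khat N l - khat N k = (l : ℤ) - (k : ℤ) := by simp only [khat]; ring
  generalize khat N k = a at *
  generalize khat N l = b at *
  rcases lt_trichotomy ((l : ℤ) - k) 0 with h | h | h
  · by_cases h1 : (l : ℤ) = k - 1
    · obtain rfl : a = b + 1 := by omega
      have h2 : ¬ (k : ℤ) = l - 1 := by omega
      have h3 : ¬ (k : ℤ) = l := by omega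
      have h4 : (k : ℤ) = l + 1 := by omega
      rw [if_pos h1, if_neg h2, if_neg h3, if_pos h4]
      rcases lt_trichotomy b (-1) with hb | rfl | hb
      · rw [if_neg (by omega), if_neg (by omega)]
        simp
        ring
      · simp
      · rw [if_pos (by omega), if_pos (by omega)]
        simp
        ring
    · have h2 : ¬ (k : ℤ) = l - 1 := by omega
      have h3 : ¬ (k : ℤ) = l := by omega
      have h4 : ¬ (k : ℤ) = l + 1 := by omega
      have h5 : ¬ (l : ℤ) = k + 1 := by omega
      rw [if_neg h1, if_neg h2, if_neg h3, if_neg (Ne.symm h3), if_neg h4, if_neg h5]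
      simp
  · obtain rfl : a = b := by omega
    have h1 : ¬ (l : ℤ) = k - 1 := by omega
    have h2 : ¬ (k : ℤ) = l - 1 := by omega
    have h3 : (k : ℤ) = l := by omega
    rw [if_neg h1, if_neg h2, if_pos h3, if_pos h3.symm]
    split_ifs <;> simp <;> ring
  · by_cases h1 : (k : ℤ) = l - 1
    · obtain rfl : b = a + 1 := by omega
      have h2 : ¬ (l : ℤ) = k - 1 := by omega
      have h3 : ¬ (l : ℤ) = k := by omega
      have h4 : (l : ℤ) = k + 1 := by omega
      rw [if_pos h1, if_neg h2, if_neg h3, if_pos h4]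
      rcases lt_trichotomy a (-1) with ha | rfl | ha
      · rw [if_neg (by omega), if_neg (by omega)]
        simp
        ring
      · simp
      · rw [if_pos (by omega), if_pos (by omega)]
        simp
        ring
    · have h2 : ¬ (l : ℤ) = k - 1 := by omega
      have h3 : ¬ (l : ℤ) = k := by omega
      have h4 : ¬ (l : ℤ) = k + 1 := by omega
      have h5 : ¬ (k : ℤ) = l + 1 := by omega
      rw [if_neg h1, if_neg h2, if_neg h3, if_neg (Ne.symm h3), if_neg h4, if_neg h5]
      simp

/-- The conjugated energy matrix `M3 = P̄ G H S1 F P` is Hermitian. -/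
theorem M3_Hermitian (N : ℕ) (hN : Even N) (hN0 : 0 < N)
    (α : ℝ) (hα : 0 < α) (x : Fin N → ℝ) :
    (PbarM N α x * Gm N * Hm N * S1 N α * Fm N * Pm N α x)ᴴ
      = PbarM N α x * Gm N * Hm N * S1 N α * Fm N * Pm N α x := by
  have hN' : (N : ℂ) ≠ 0 := by exact_mod_cast hN0.ne'
  have hHS : (S1 N α)ᴴ * (Hm N)ᴴ = Hm N * S1 N α := by
    rw [← conjTranspose_mul, (isHermitian_Hm_mul_S1 N α).eq]
  calc (PbarM N α x * Gm N * Hm N * S1 N α * Fm N * Pm N α x)ᴴ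
      = (Pm N α x)ᴴ * (Fm N)ᴴ * ((S1 N α)ᴴ * (Hm N)ᴴ) * (Gm N)ᴴ * (PbarM N α x)ᴴ := by
        simp only [conjTranspose_mul, Matrix.mul_assoc]
    _ = PbarM N α x * Gm N * Hm N * S1 N α * Fm N * Pm N α x := by
        rw [hHS, conjTranspose_Pm, conjTranspose_PbarM, conjTranspose_Fm,
          conjTranspose_Gm N hN0]
        simp [Matrix.mul_assoc, smul_smul, hN']
end

section
/- For every real vector u : Fin N → ℝ (coerced into Fin N → ℂ), the real part of ⟨f_M(u), u⟩_h is zero, where f_M(u) := B_{HS2}u − (1/(m+1))·(u^{∘(m−1)} ⊙ (B_{S1}u) + B_{S1}(u^{∘m})) (the key identity in the proof of the semi-discrete mass conservation). -/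
open Matrix Complex BigOperators

/-- The synthesis matrix is `N` times the adjoint of the analysis matrix. -/
theorem Gm_eq_smul_conjTranspose_Fm (N : ℕ) (hN0 : 0 < N) : Gm N = (N : ℂ) • (Fm N)ᴴ := by
  have hN : (N : ℂ) ≠ 0 := by exact_mod_cast hN0.ne'
  ext j k
  simp [Gm, Fm, Matrix.conjTranspose_apply, ← Complex.exp_conj, hN]

theorem conjTranspose_S2 (N : ℕ) (α : ℝ) : (S2 N α)ᴴ = S2 N α := by
  simp [S2, Matrix.conjTranspose_mul, conjTranspose_S1]

theorem conjTranspose_Hm_mul_S2 (N : ℕ) (α : ℝ) : (Hm N * S2 N α)ᴴ = -(Hm N * S2 N α) := by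
  have h : Commute (Hm N) (S2 N α) := (commute_Hm_S1 N α).mul_right (commute_Hm_S1 N α)
  rw [Matrix.conjTranspose_mul, conjTranspose_S2, conjTranspose_Hm, mul_neg, h.eq]

/-- The discrete inner product turns conjugation by the weighted transform into a
sesquilinear form on Fourier coefficients. -/
theorem iph_conjugated_mulVec (N : ℕ) (hN0 : 0 < N) (α : ℝ) (hα : 0 < α) (x : Fin N → ℝ)
    (A : Matrix (Fin N) (Fin N) ℂ) (u v : Fin N → ℂ) :
    iph N α x ((PinvM N α x * Gm N * A * Fm N * Pm N α x) *ᵥ u) v =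
      ((Real.pi / (N * α) * N : ℝ) : ℂ) *
        (star ((Fm N * Pm N α x) *ᵥ v) ⬝ᵥ A *ᵥ ((Fm N * Pm N α x) *ᵥ u)) := by
  have key : ∀ w : Fin N → ℂ,
      ∑ j, ((α ^ 2 + x j ^ 2 : ℝ) : ℂ) * (PinvM N α x *ᵥ w) j * (starRingEnd ℂ) (v j) =
        star (Pm N α x *ᵥ v) ⬝ᵥ w := by
    intro w
    refine Finset.sum_congr rfl fun j _ => ?_
    have hne : (α : ℂ) - Complex.I * (x j : ℂ) ≠ 0 := fun h => by
      have := congrArg Complex.re h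
      simp at this
      exact hα.ne' this
    simp only [PinvM, Pm, Matrix.mulVec_diagonal, Pi.star_apply, star_mul', RCLike.star_def,
      map_sub, map_mul, Complex.conj_ofReal, Complex.conj_I]
    field_simp
    push_cast
    linear_combination ((x j : ℂ) ^ 2 * w j * (starRingEnd ℂ) (v j)) * Complex.I_sq
  rw [iph]
  simp only [Matrix.mul_assoc, ← Matrix.mulVec_mulVec] at key ⊢
  rw [key, Gm_eq_smul_conjTranspose_Fm N hN0, Matrix.smul_mulVec, dotProduct_smul,
    Matrix.star_mulVec (Fm N), Matrix.dotProduct_mulVec _ (Fm N)ᴴ]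
  push_cast
  rw [smul_eq_mul, mul_assoc]

/-- Conjugating a skew-Hermitian matrix gives an operator which is skew-adjoint for the
discrete inner product. -/
theorem iph_conjugated_mulVec_skew (N : ℕ) (hN0 : 0 < N) (α : ℝ) (hα : 0 < α) (x : Fin N → ℝ)
    {A : Matrix (Fin N) (Fin N) ℂ} (hA : Aᴴ = -A) (u v : Fin N → ℂ) :
    (iph N α x ((PinvM N α x * Gm N * A * Fm N * Pm N α x) *ᵥ u) v).re =
      -(iph N α x ((PinvM N α x * Gm N * A * Fm N * Pm N α x) *ᵥ v) u).re := by
  have skew : ∀ a b : Fin N → ℂ, (star b ⬝ᵥ A *ᵥ a).re = -(star a ⬝ᵥ A *ᵥ b).re := by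
    intro a b
    have h : star (star b ⬝ᵥ A *ᵥ a) = -(star a ⬝ᵥ A *ᵥ b) := by
      rw [← Matrix.star_dotProduct_star, star_star, Matrix.star_mulVec, hA,
        ← Matrix.dotProduct_mulVec, Matrix.neg_mulVec, dotProduct_neg]
    simpa using congrArg Complex.re h
  rw [iph_conjugated_mulVec N hN0 α hα, iph_conjugated_mulVec N hN0 α hα,
    Complex.re_ofReal_mul, Complex.re_ofReal_mul, skew, mul_neg]

/-- For every real vector `u`, the real part of `⟨f_M(u), u⟩_h` vanishes: the key
identity in the proof of the semi-discrete mass conservation. -/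
theorem re_iph_fM_eq_zero (N : ℕ) (hN : Even N) (hN0 : 0 < N)
    (α : ℝ) (hα : 0 < α) (x : Fin N → ℝ) (m : ℕ) (hm : 1 ≤ m) (u : Fin N → ℝ) :
    (iph N α x (fM N α x m (cv N u)) (cv N u)).re = 0 := by
  have hB : (iph N α x (BHS2 N α x *ᵥ cv N u) (cv N u)).re = 0 := by
    have h := iph_conjugated_mulVec_skew N hN0 α hα x (conjTranspose_Hm_mul_S2 N α)
      (cv N u) (cv N u)
    rw [← Matrix.mul_assoc] at h
    change (iph N α x (BHS2 N α x *ᵥ cv N u) (cv N u)).re =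
      -(iph N α x (BHS2 N α x *ᵥ cv N u) (cv N u)).re at h
    linarith
  have hS : (iph N α x (BS1 N α x *ᵥ cv N u) (pw N m (cv N u))).re =
      -(iph N α x (BS1 N α x *ᵥ pw N m (cv N u)) (cv N u)).re :=
    iph_conjugated_mulVec_skew N hN0 α hα x (conjTranspose_S1 N α) _ _
  have split : iph N α x (fM N α x m (cv N u)) (cv N u) =
      iph N α x (BHS2 N α x *ᵥ cv N u) (cv N u) -
        ((1 / ((m : ℝ) + 1) : ℝ) : ℂ) *
          (iph N α x (BS1 N α x *ᵥ cv N u) (pw N m (cv N u)) +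
            iph N α x (BS1 N α x *ᵥ pw N m (cv N u)) (cv N u)) := by
    simp only [iph]
    rw [← mul_add, mul_left_comm, ← mul_sub, ← Finset.sum_add_distrib]
    congr 1
    rw [Finset.mul_sum, ← Finset.sum_sub_distrib]
    refine Finset.sum_congr rfl fun j _ => ?_
    obtain ⟨n, rfl⟩ : ∃ n, m = n + 1 := ⟨m - 1, by omega⟩
    simp only [fM, Nat.add_sub_cancel]
    generalize (BHS2 N α x *ᵥ cv N u) j = a
    generalize (BS1 N α x *ᵥ cv N u) j = b
    generalize (BS1 N α x *ᵥ pw N (n + 1) (cv N u)) j = c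
    simp only [pw, cv, map_pow, Complex.conj_ofReal]
    push_cast
    ring
  rw [split, Complex.sub_re, Complex.re_ofReal_mul, Complex.add_re, hB, hS]
  ring
end
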